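/- Let φ be an admissible deformation on Ω (i.e., φ ∈ (W^{m,2}(Ω))^n with m > 1 + n/2, det(Dφ) > 0 almost everywhere in Ω, and φ(x) = x for x ∈ ∂Ω). Then φ maps Lebesgue null sets to Lebesgue null sets, and moreover the pre-image deformation also maps null sets to null sets: for every Borel null set N ⊆ Ω̄ one has μ(φ^{-1}(N)) = 0. -/

import Mathlib

open MeasureTheory Set Filter Topology
open scoped ENNReal NNReal RealInnerProductSpace

noncomputable section
open scoped Classical

abbrev E (n : ℕ) := EuclideanSpace ℝ (Fin n)

/-- Admissible deformation on `Ω`: encodes `φ ∈ (W^{m,2}(Ω))^n` (via `C^{1,α}` regularity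
consequences), `det Dφ > 0` a.e., identity on the boundary, together with the derived
properties from Ball's theorem: `φ(Ω̄) = Ω̄`, change of variables, a.e. injectivity. -/
structure Admissible {n : ℕ} (Ω : Set (E n)) where
  toFun : E n → E n
  deriv : E n → (E n →L[ℝ] E n)
  hasDeriv : ∀ x ∈ Ω, HasFDerivAt toFun (deriv x) x
  derivCont : ContinuousOn deriv (closure Ω)
  lipschitz : ∃ L : ℝ≥0, LipschitzOnWith L toFun (closure Ω)
  det_pos : ∀ᵐ x ∂(volume.restrict Ω), 0 < (deriv x).det
  boundary_id : ∀ x ∈ frontier Ω, toFun x = x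
  image_closure : toFun '' closure Ω = closure Ω
  /-- the non-injectivity set: outside `S`, points of `Ω̄` have a unique preimage -/
  S : Set (E n)
  S_null : volume S = 0
  inv_unique : ∀ x ∈ closure Ω \ S, ∃! y, y ∈ closure Ω ∧ toFun y = x
  change_of_var : ∀ B ⊆ closure Ω, MeasurableSet B →
    ∀ I : E n → ℝ≥0∞, Measurable I →
      ∫⁻ x in B, I (toFun x) * ENNReal.ofReal ((deriv x).det) ∂volume
        = ∫⁻ y in toFun '' B, I y ∂volume

namespace Admissible

variable {n : ℕ} {Ω : Set (E n)}

/-- the a.e. defined inverse deformation -/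
def inv (φ : Admissible Ω) : E n → E n := Function.invFunOn φ.toFun (closure Ω)

/-- the concatenation `I ∘ φ⁻¹`: equal to `I (φ⁻¹ x)` on `ℬ = Ω \ N` and `0` otherwise -/
def conc (φ : Admissible Ω) (N : Set (E n)) (I : E n → ℝ) : E n → ℝ :=
  fun x => if x ∈ Ω \ N then I (φ.inv x) else 0

/-- the concatenation `I ∘ φ⁻¹` with the canonical choice `N = S` -/
def concS (φ : Admissible Ω) (I : E n → ℝ) : E n → ℝ := φ.conc φ.S I

end Admissible


/-- Lemma 2.1: an admissible deformation `φ` maps Lebesgue null sets to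
null sets, and its pre-image deformation also maps null sets to null sets: for every Borel
null set `N ⊆ Ω̄` one has `μ(φ⁻¹(N)) = 0`. -/
theorem admissible_maps_null_to_null {n : ℕ} (Ω : Set (E n))
    (hΩne : Ω.Nonempty) (hΩo : IsOpen Ω) (hΩc : IsConnected Ω)
    (hΩb : Bornology.IsBounded Ω) (φ : Admissible Ω) :
    (∀ N ⊆ closure Ω, volume N = 0 → volume (φ.toFun '' N) = 0) ∧
    (∀ N ⊆ closure Ω, MeasurableSet N → volume N = 0 →
      volume (closure Ω ∩ φ.toFun ⁻¹' N) = 0) := by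
  have cont : ContinuousOn φ.toFun Ω :=
    fun x hx => (φ.hasDeriv x hx).continuousAt.continuousWithinAt
  have split : ∀ x ∈ closure Ω, x ∈ Ω ∨ x ∈ frontier Ω := fun x hx => by
    by_cases h : x ∈ Ω
    · exact Or.inl h
    · exact Or.inr (by rw [hΩo.frontier_eq]; exact ⟨hx, h⟩)
  refine ⟨fun N hN hN0 => ?_, fun N hN hNm hN0 => ?_⟩
  · have hsub : φ.toFun '' N ⊆ φ.toFun '' (N ∩ Ω) ∪ N := by
      rintro _ ⟨x, hx, rfl⟩
      rcases split x (hN hx) with h | h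
      · exact Or.inl ⟨x, ⟨hx, h⟩, rfl⟩
      · exact Or.inr (by rwa [φ.boundary_id x h])
    refine measure_mono_null hsub (measure_union_null ?_ hN0)
    refine addHaar_image_eq_zero_of_differentiableOn_of_addHaar_eq_zero volume ?_
      (measure_mono_null inter_subset_left hN0)
    exact fun x hx => (φ.hasDeriv x hx.2).differentiableAt.differentiableWithinAt
  · set B := Ω ∩ φ.toFun ⁻¹' N
    have hsub : closure Ω ∩ φ.toFun ⁻¹' N ⊆ B ∪ N := by
      rintro x ⟨hx, hxN⟩
      rcases split x hx with h | h
      · exact Or.inl ⟨h, hxN⟩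
      · exact Or.inr (by rwa [mem_preimage, φ.boundary_id x h] at hxN)
    refine measure_mono_null hsub (measure_union_null ?_ hN0)
    have hBm : MeasurableSet B := by
      have h := hΩo.measurableSet.subtype_image (cont.domRestrict.measurable hNm)
      rwa [domRestrict_eq, preimage_comp, Subtype.image_preimage_coe] at h
    have hint : ∫⁻ x in B, ENNReal.ofReal ((φ.deriv x).det) = 0 := by
      have h := φ.change_of_var B (inter_subset_left.trans subset_closure) hBm
        (fun _ => 1) measurable_const
      simp only [one_mul, setLIntegral_one] at h
      rw [h]
      exact measure_mono_null (by rintro _ ⟨x, hx, rfl⟩; exact hx.2) hN0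
    have hdet : AEMeasurable (fun x => ENNReal.ofReal ((φ.deriv x).det))
        (volume.restrict B) := by
      have hc : ContinuousOn (fun x => (φ.deriv x).det) B :=
        ContinuousLinearMap.continuous_det.comp_continuousOn
          (φ.derivCont.mono (inter_subset_left.trans subset_closure))
      exact (hc.aemeasurable hBm).ennreal_ofReal
    have hzero := (lintegral_eq_zero_iff' hdet).1 hint
    have hpos := ae_mono (Measure.restrict_mono_set volume (inter_subset_left : B ⊆ Ω))
      φ.det_pos
    rw [← Measure.restrict_eq_zero, ← ae_eq_bot, ← eventually_false_iff_eq_bot]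
    filter_upwards [hzero, hpos] with x h0 h1
    exact h1.not_ge (ENNReal.ofReal_eq_zero.1 h0)
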